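/- Hessian decomposition and uniform limit (Lemma 10, deterministic core): $K^{i,j}_{n,\varepsilon}(\theta) := \partial_{\theta_j} G^i_{n,\varepsilon}(\theta)$ equals $\sum_{k=0}^{n-1} \partial_{\theta_j}\partial_{\theta_i} b(X_{t_k},\theta)\big(\delta X_{t_k t_{k+1}} - \tfrac1n b(X_{t_k},\theta_0)\big) + \frac1n\sum_{k=0}^{n-1}\big[\partial_{\theta_i}\partial_{\theta_j} b(X_{t_k},\theta)(b(X_{t_k},\theta_0) - b(X_{t_k},\theta)) - \partial_{\theta_i} b(X_{t_k},\theta)\partial_{\theta_j} b(X_{t_k},\theta)\big]$, and under assumptions (A1), (A3)–(A4) together with either $H > 1/2$, or $H \le 1/2$ and $\varepsilon^2 n^{1-H} \to 0$, one has $\sup_{\theta \in \Theta} |K^{i,j}_{n,\varepsilon}(\theta) - K^{i,j}(\theta)| \to 0$ a.s. as $n \to \infty$, $\varepsilon \downarrow 0$, where $K^{i,j}(\theta) = \int_0^T \partial_{\theta_j}\partial_{\theta_i} b(x_s^{\theta_0},\theta)(b(x_s^{\theta_0},\theta_0) - b(x_s^{\theta_0},\theta))\,ds - \int_0^T \partial_{\theta_i}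 b(x_s^{\theta_0},\theta)\partial_{\theta_j} b(x_s^{\theta_0},\theta)\,ds$. -/

import Mathlib

open Filter

/-- Integral form of Grönwall's inequality on `[0, 1]`. -/
lemma abs_le_mul_exp_of_le_add_mul_integral {f : ℝ → ℝ} {A c : ℝ} (hc : 0 < c) (hA : 0 ≤ A)
    (hf : ContinuousOn f (Set.Icc 0 1))
    (h : ∀ t ∈ Set.Icc (0:ℝ) 1, |f t| ≤ A + c * ∫ s in (0:ℝ)..t, |f s|) :
    ∀ t ∈ Set.Icc (0:ℝ) 1, |f t| ≤ A * Real.exp c := by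
  set F : ℝ → ℝ := Set.IccExtend zero_le_one ((Set.Icc (0:ℝ) 1).domRestrict f) with hF
  have hFc : Continuous F := (continuousOn_iff_continuous_domRestrict.mp hf).Icc_extend'
  have hFf : ∀ t ∈ Set.Icc (0:ℝ) 1, F t = f t := fun t ht => by
    rw [hF, Set.IccExtend_of_mem _ _ ht]; rfl
  have hint : ∀ t ∈ Set.Icc (0:ℝ) 1, ∫ s in (0:ℝ)..t, |F s| = ∫ s in (0:ℝ)..t, |f s| := by
    intro t ht
    refine intervalIntegral.integral_congr fun s hs => ?_
    rw [Set.uIcc_of_le ht.1] at hs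
    simp only [hFf s ⟨hs.1, hs.2.trans ht.2⟩]
  have hder : ∀ t, HasDerivAt (fun u => ∫ s in (0:ℝ)..u, |F s|) |F t| t := fun t =>
    intervalIntegral.integral_hasDerivAt_right (hFc.abs.intervalIntegrable _ _)
      hFc.abs.stronglyMeasurable.stronglyMeasurableAtFilter hFc.abs.continuousAt
  have hnn : ∀ t ∈ Set.Icc (0:ℝ) 1, 0 ≤ ∫ s in (0:ℝ)..t, |F s| := fun t ht =>
    intervalIntegral.integral_nonneg ht.1 fun _ _ => abs_nonneg _
  intro t ht
  have key := norm_le_gronwallBound_of_norm_deriv_right_le (f := fun u => ∫ s in (0:ℝ)..u, |F s|)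
    (f' := fun u => |F u|) (δ := 0) (K := c) (ε := A) (a := 0) (b := 1)
    (fun u _ => (hder u).continuousAt.continuousWithinAt)
    (fun u _ => (hder u).hasDerivWithinAt) (by simp)
    (fun u hu => by
      have hu' : u ∈ Set.Icc (0:ℝ) 1 := ⟨hu.1, hu.2.le⟩
      rw [Real.norm_eq_abs, Real.norm_eq_abs, abs_of_nonneg (hnn u hu'), abs_abs, hFf u hu',
        hint u hu']
      linarith [h u hu']) t ht
  rw [gronwallBound_of_K_ne_0 hc.ne', Real.norm_eq_abs, abs_of_nonneg (hnn t ht), hint t ht]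
    at key
  have hexp : Real.exp (c * t) ≤ Real.exp c := Real.exp_le_exp.mpr (by nlinarith [ht.2])
  simp only [sub_zero, zero_mul, zero_add] at key
  calc |f t| ≤ A + c * ∫ s in (0:ℝ)..t, |f s| := h t ht
    _ ≤ A + c * (A / c * (Real.exp (c * t) - 1)) := by gcongr
    _ = A * Real.exp (c * t) := by field_simp; ring
    _ ≤ A * Real.exp c := by gcongr

/-- Discrete sewing estimate for Hölder sequences with exponents summing to more than one. -/
lemma abs_sum_sub_mul_sub_le_of_holder {a w : ℕ → ℝ} {n : ℕ} {lam A B : ℝ} (hl : 1 / 2 < lam)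
    (hA : 0 ≤ A) (hB : 0 ≤ B)
    (ha : ∀ k m, k + m ≤ n → |a (k + m) - a k| ≤ A * (m : ℝ) ^ lam)
    (hw : ∀ k m, k + m ≤ n → |w (k + m) - w k| ≤ B * (m : ℝ) ^ lam) (m : ℕ) :
    ∀ p, p + m ≤ n →
      |∑ k ∈ Finset.range m, (a (p + k) - a p) * (w (p + k + 1) - w (p + k))|
        ≤ A * B / (1 - (2 / 3 : ℝ) ^ (2 * lam - 1)) * (m : ℝ) ^ (2 * lam) := by
  set r : ℝ := (2 / 3 : ℝ) ^ (2 * lam - 1) with hr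
  have hr1 : r < 1 := Real.rpow_lt_one (by norm_num) (by norm_num) (by linarith)
  set Q := A * B / (1 - r) with hQ
  have hQ0 : 0 ≤ Q := div_nonneg (mul_nonneg hA hB) (by linarith)
  induction m using Nat.strong_induction_on with
  | _ m ih =>
  intro p hp
  rcases Nat.lt_or_ge m 2 with hm | hm
  · interval_cases m
    · simpa using mul_nonneg hQ0 (Real.rpow_nonneg le_rfl _)
    · simpa using hQ0
  obtain ⟨m₁, m₂, hsum, h1, h2, hlt1, hlt2⟩ : ∃ m₁ m₂, m = m₁ + m₂ ∧ 3 * m₁ ≤ 2 * m ∧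
      3 * m₂ ≤ 2 * m ∧ m₁ < m ∧ m₂ < m := ⟨m / 2, m - m / 2, by omega⟩
  have hsplit : ∑ k ∈ Finset.range m, (a (p + k) - a p) * (w (p + k + 1) - w (p + k))
      = ∑ k ∈ Finset.range m₁, (a (p + k) - a p) * (w (p + k + 1) - w (p + k))
        + ∑ k ∈ Finset.range m₂,
            (a (p + m₁ + k) - a (p + m₁)) * (w (p + m₁ + k + 1) - w (p + m₁ + k))
        + (a (p + m₁) - a p) * (w (p + m₁ + m₂) - w (p + m₁)) := by
    have htel := Finset.sum_range_sub (fun k => w (p + m₁ + k)) m₂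
    simp only [add_zero] at htel
    rw [hsum, Finset.sum_range_add, add_assoc, ← htel, Finset.mul_sum, ← Finset.sum_add_distrib]
    congr 1
    refine Finset.sum_congr rfl fun k _ => ?_
    simp only [← add_assoc]
    ring
  have hm0 : (0:ℝ) < m := by exact_mod_cast (by omega : 0 < m)
  have hpow : ∀ q : ℕ, 3 * q ≤ 2 * m → (q : ℝ) ^ (2 * lam) ≤ r * (m : ℝ) ^ (2 * lam - 1) * q := by
    intro q hq
    have hq' : (q : ℝ) ≤ 2 / 3 * m := by
      have : (3 * q : ℝ) ≤ 2 * m := by exact_mod_cast hq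
      linarith
    calc (q : ℝ) ^ (2 * lam) = (q : ℝ) ^ (2 * lam - 1) * q := by
          rw [← Real.rpow_add_one' (by positivity) (by linarith), sub_add_cancel]
      _ ≤ (2 / 3 * m : ℝ) ^ (2 * lam - 1) * q := by gcongr; linarith
      _ = r * (m : ℝ) ^ (2 * lam - 1) * q := by
          rw [Real.mul_rpow (by norm_num) hm0.le]
  have hcast : (m : ℝ) = m₁ + m₂ := by exact_mod_cast hsum
  have hle1 : (m₁ : ℝ) ≤ m := by exact_mod_cast hlt1.le
  have hle2 : (m₂ : ℝ) ≤ m := by exact_mod_cast hlt2.le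
  have e1 := ih m₁ hlt1 p (by omega)
  have e2 := ih m₂ hlt2 (p + m₁) (by omega)
  have e3 : |(a (p + m₁) - a p) * (w (p + m₁ + m₂) - w (p + m₁))|
      ≤ A * B * (m : ℝ) ^ (2 * lam) := by
    have hl0 : 0 ≤ lam := by linarith
    rw [abs_mul]
    calc _ ≤ (A * (m₁ : ℝ) ^ lam) * (B * (m₂ : ℝ) ^ lam) :=
          mul_le_mul (ha p m₁ (by omega)) (hw (p + m₁) m₂ (by omega)) (abs_nonneg _) (by positivity)
      _ ≤ (A * (m : ℝ) ^ lam) * (B * (m : ℝ) ^ lam) := by gcongr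
      _ = A * B * (m : ℝ) ^ (2 * lam) := by rw [two_mul, Real.rpow_add hm0]; ring
  have hpm : r * (m : ℝ) ^ (2 * lam - 1) * m = r * (m : ℝ) ^ (2 * lam) := by
    rw [mul_assoc, ← Real.rpow_add_one hm0.ne', sub_add_cancel]
  have hQr : Q * (1 - r) = A * B := div_mul_cancel₀ _ (by linarith)
  rw [hsplit]
  calc _ ≤ Q * (m₁ : ℝ) ^ (2 * lam) + Q * (m₂ : ℝ) ^ (2 * lam) + A * B * (m : ℝ) ^ (2 * lam) :=
        (abs_add_three _ _ _).trans (by gcongr)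
    _ ≤ Q * (r * (m : ℝ) ^ (2 * lam - 1) * m₁) + Q * (r * (m : ℝ) ^ (2 * lam - 1) * m₂)
        + A * B * (m : ℝ) ^ (2 * lam) := by gcongr <;> [exact hpow _ h1; exact hpow _ h2]
    _ = Q * (r * (m : ℝ) ^ (2 * lam - 1) * m) + A * B * (m : ℝ) ^ (2 * lam) := by
        rw [hcast]; ring
    _ = Q * (m : ℝ) ^ (2 * lam) := by rw [hpm, ← hQr]; ring

/-- Discrete Young estimate. -/
lemma abs_sum_mul_sub_le_of_holder {a w : ℕ → ℝ} {n : ℕ} {lam A B : ℝ} (hl : 1 / 2 < lam)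
    (hA : 0 ≤ A) (hB : 0 ≤ B)
    (ha : ∀ k m, k + m ≤ n → |a (k + m) - a k| ≤ A * (m : ℝ) ^ lam)
    (hw : ∀ k m, k + m ≤ n → |w (k + m) - w k| ≤ B * (m : ℝ) ^ lam) :
    |∑ k ∈ Finset.range n, a k * (w (k + 1) - w k)|
      ≤ |a 0| * |w n - w 0| + A * B / (1 - (2 / 3 : ℝ) ^ (2 * lam - 1)) * (n : ℝ) ^ (2 * lam) := by
  have h := abs_sum_sub_mul_sub_le_of_holder hl hA hB ha hw n 0 (by simp)
  have hsplit : ∑ k ∈ Finset.range n, a k * (w (k + 1) - w k) = a 0 * (w n - w 0)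
      + ∑ k ∈ Finset.range n, (a (0 + k) - a 0) * (w (0 + k + 1) - w (0 + k)) := by
    rw [← Finset.sum_range_sub w n, Finset.mul_sum, ← Finset.sum_add_distrib]
    refine Finset.sum_congr rfl fun k _ => ?_
    rw [zero_add]; ring
  rw [hsplit, ← abs_mul]
  exact (abs_add_le _ _).trans (by gcongr)

/-- Summation by parts bound. -/
lemma abs_sum_mul_sub_le_by_parts (a w : ℕ → ℝ) (n : ℕ) :
    |∑ k ∈ Finset.range n, a k * (w (k + 1) - w k)|
      ≤ |a n| * |w n| + |a 0| * |w 0| + ∑ k ∈ Finset.range n, |a (k + 1) - a k| * |w (k + 1)| := by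
  have h : ∑ k ∈ Finset.range n, a k * (w (k + 1) - w k) = a n * w n - a 0 * w 0
      - ∑ k ∈ Finset.range n, (a (k + 1) - a k) * w (k + 1) := by
    rw [← Finset.sum_range_sub (fun k => a k * w k) n, ← Finset.sum_sub_distrib]
    exact Finset.sum_congr rfl fun k _ => by ring
  rw [h]
  refine (abs_sub _ _).trans (add_le_add ((abs_sub _ _).trans (by simp only [abs_mul]; rfl)) ?_)
  exact (Finset.abs_sum_le_sum_abs _ _).trans (by simp only [abs_mul]; rfl)

/-- Hölder's inequality between the `1`-variation and the `1/H`-variation sums. -/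
lemma sum_abs_le_card_rpow_mul {u : ℕ → ℝ} {n : ℕ} {H : ℝ} (hH : H ∈ Set.Ioo (0:ℝ) 1) :
    ∑ k ∈ Finset.range n, |u k|
      ≤ (n : ℝ) ^ (1 - H) * (∑ k ∈ Finset.range n, |u k| ^ (1 / H)) ^ H := by
  have h := Real.rpow_sum_le_const_mul_sum_rpow (Finset.range n) u (p := 1 / H)
    (by rw [le_div_iff₀ hH.1]; linarith [hH.2])
  have h0 : 0 ≤ ∑ k ∈ Finset.range n, |u k| := Finset.sum_nonneg fun _ _ => abs_nonneg _
  have h2 := Real.rpow_le_rpow (Real.rpow_nonneg h0 _) h hH.1.le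
  rw [← Real.rpow_mul h0, one_div_mul_cancel hH.1.ne', Real.rpow_one, Finset.card_range,
    Real.mul_rpow (by positivity) (Finset.sum_nonneg fun _ _ => by positivity),
    ← Real.rpow_mul (by positivity), sub_mul, one_div_mul_cancel hH.1.ne', one_mul] at h2
  exact h2

lemma abs_integral_sub_mul_le {f : ℝ → ℝ} {u v y δ : ℝ} (huv : u ≤ v)
    (hf : ContinuousOn f (Set.Icc u v)) (h : ∀ s ∈ Set.Icc u v, |f s - y| ≤ δ) :
    |(∫ s in u..v, f s) - (v - u) * y| ≤ δ * (v - u) := by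
  have e : (∫ s in u..v, f s) - (v - u) * y = ∫ s in u..v, (f s - y) := by
    rw [intervalIntegral.integral_sub (hf.intervalIntegrable_of_Icc huv) (by simp)]
    simp
  rw [e]
  have := intervalIntegral.norm_integral_le_of_norm_le_const (a := u) (b := v) (C := δ)
    (f := fun s => f s - y) fun s hs => by
      rw [Set.uIoc_of_le huv] at hs
      exact h s ⟨hs.1.le, hs.2⟩
  rwa [Real.norm_eq_abs, abs_of_nonneg (sub_nonneg.mpr huv)] at this

lemma div_mem_unitInterval {k n : ℕ} (h : k ≤ n) : (k : ℝ) / n ∈ Set.Icc (0:ℝ) 1 :=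
  ⟨by positivity, div_le_one_of_le₀ (by exact_mod_cast h) (by positivity)⟩

lemma Icc_grid_subset {k n : ℕ} (h : k < n) :
    Set.Icc ((k : ℝ) / n) (((k : ℝ) + 1) / n) ⊆ Set.Icc (0:ℝ) 1 := by
  have h2 : ((k : ℝ) + 1) / n ∈ Set.Icc (0:ℝ) 1 := by
    exact_mod_cast div_mem_unitInterval (Nat.succ_le_of_lt h)
  exact Set.Icc_subset_Icc (div_mem_unitInterval h.le).1 h2.2

lemma grid_le (k n : ℕ) : (k : ℝ) / n ≤ ((k : ℝ) + 1) / n := by gcongr; linarith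

lemma grid_sub (k n : ℕ) : ((k : ℝ) + 1) / n - (k : ℝ) / n = 1 / n := by ring

/-- Error of a Riemann sum with approximate nodes. -/
lemma abs_riemann_sum_sub_integral_le {f : ℝ → ℝ} {y : ℕ → ℝ} {n : ℕ} {δ : ℝ} (hn : 0 < n)
    (hf : ContinuousOn f (Set.Icc 0 1))
    (h : ∀ k < n, ∀ s ∈ Set.Icc ((k : ℝ) / n) (((k : ℝ) + 1) / n), |f s - y k| ≤ δ) :
    |(1 / (n : ℝ)) * (∑ k ∈ Finset.range n, y k) - ∫ s in (0:ℝ)..1, f s| ≤ δ := by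
  have hn' : (n : ℝ) ≠ 0 := by positivity
  have hs := intervalIntegral.sum_integral_adjacent_intervals (f := f) (μ := MeasureTheory.volume)
    (a := fun k : ℕ => (k : ℝ) / n) (n := n) (fun k hk => by
      push_cast
      exact (hf.mono (Icc_grid_subset hk)).intervalIntegrable_of_Icc (grid_le k n))
  simp only [Nat.cast_zero, zero_div, div_self hn', Nat.cast_add, Nat.cast_one] at hs
  rw [← hs, abs_sub_comm, Finset.mul_sum, ← Finset.sum_sub_distrib]
  calc _ ≤ ∑ k ∈ Finset.range n, δ * (1 / n) := by
        refine (Finset.abs_sum_le_sum_abs _ _).trans (Finset.sum_le_sum fun k hk => ?_)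
        have hk := Finset.mem_range.mp hk
        have := abs_integral_sub_mul_le (grid_le k n) (hf.mono (Icc_grid_subset hk)) (h k hk)
        rwa [grid_sub] at this
    _ = δ := by rw [Finset.sum_const, Finset.card_range, nsmul_eq_mul]; field_simp

lemma continuous_of_abs_sub_le_pow {f : ℝ → ℝ} {C : ℝ} {N : ℕ}
    (h : ∀ y z, |f y - f z| ≤ C * (1 + |y| ^ N + |z| ^ N) * |y - z|) : Continuous f := by
  refine continuous_iff_continuousAt.mpr fun z => ?_
  rw [ContinuousAt, tendsto_iff_dist_tendsto_zero]
  have hg : Continuous fun y : ℝ => C * (1 + |y| ^ N + |z| ^ N) * |y - z| := by fun_prop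
  refine squeeze_zero (fun _ => dist_nonneg) (fun y => h y z) ?_
  simpa using hg.tendsto z

lemma abs_mul_sub_mul_le {p q p' q' P Q a b : ℝ} (hq : |q| ≤ Q) (hp' : |p'| ≤ P)
    (ha : |p - p'| ≤ a) (hb : |q - q'| ≤ b) : |p * q - p' * q'| ≤ a * Q + P * b := by
  have e : p * q - p' * q' = (p - p') * q + p' * (q - q') := by ring
  rw [e]
  refine (abs_add_le _ _).trans ?_
  rw [abs_mul, abs_mul]
  exact add_le_add (mul_le_mul ha hq (abs_nonneg _) ((abs_nonneg _).trans ha))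
    (mul_le_mul hp' hb (abs_nonneg _) ((abs_nonneg _).trans hp'))

lemma add_div_sub_div (k m n : ℕ) : ((k + m : ℕ) : ℝ) / n - (k : ℝ) / n = (m : ℝ) / n := by
  push_cast; ring

/-- Riemann–Stieltjes sums of Hölder paths with exponent above one half are bounded uniformly
in the mesh. -/
lemma abs_grid_sum_le_of_holder {a W : ℝ → ℝ} {lam A B : ℝ} (hl : 1 / 2 < lam) (hA : 0 ≤ A)
    (hB : 0 ≤ B)
    (ha : ∀ s ∈ Set.Icc (0:ℝ) 1, ∀ t ∈ Set.Icc (0:ℝ) 1, |a t - a s| ≤ A * |t - s| ^ lam)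
    (hW : ∀ s ∈ Set.Icc (0:ℝ) 1, ∀ t ∈ Set.Icc (0:ℝ) 1, |W t - W s| ≤ B * |t - s| ^ lam)
    {n : ℕ} (hn : 0 < n) :
    |∑ k ∈ Finset.range n, a ((k : ℝ) / n) * (W (((k : ℝ) + 1) / n) - W ((k : ℝ) / n))|
      ≤ |a 0| * B + A * B / (1 - (2 / 3 : ℝ) ^ (2 * lam - 1)) := by
  have hn0 : (0:ℝ) < n := by exact_mod_cast hn
  have scale : ∀ {f : ℝ → ℝ} {D : ℝ},
      (∀ s ∈ Set.Icc (0:ℝ) 1, ∀ t ∈ Set.Icc (0:ℝ) 1, |f t - f s| ≤ D * |t - s| ^ lam) →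
      ∀ k m, k + m ≤ n → |f (((k + m : ℕ) : ℝ) / n) - f ((k : ℝ) / n)|
        ≤ D * ((n : ℝ) ^ lam)⁻¹ * (m : ℝ) ^ lam := by
    intro f D hf k m hkm
    refine (hf _ (div_mem_unitInterval (by omega)) _ (div_mem_unitInterval hkm)).trans (le_of_eq ?_)
    rw [add_div_sub_div, abs_of_nonneg (by positivity), Real.div_rpow (by positivity) hn0.le]
    ring
  have h := abs_sum_mul_sub_le_of_holder (a := fun k : ℕ => a ((k : ℝ) / n))
    (w := fun k : ℕ => W ((k : ℝ) / n)) (n := n) hl (by positivity) (by positivity)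
    (scale ha) (scale hW)
  have h01 : |W 1 - W 0| ≤ B := by simpa using hW 0 (by simp) 1 (by simp)
  have hp : (n : ℝ) ^ (2 * lam) = (n : ℝ) ^ lam * (n : ℝ) ^ lam := by
    rw [two_mul, Real.rpow_add hn0]
  have hp0 : (0:ℝ) < (n : ℝ) ^ lam := by positivity
  have e : A * ((n : ℝ) ^ lam)⁻¹ * (B * ((n : ℝ) ^ lam)⁻¹) / (1 - (2 / 3 : ℝ) ^ (2 * lam - 1))
      * (n : ℝ) ^ (2 * lam) = A * B / (1 - (2 / 3 : ℝ) ^ (2 * lam - 1)) := by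
    rw [hp]
    field_simp
  rw [e] at h
  simp only [Nat.cast_zero, zero_div, div_self hn0.ne', Nat.cast_add, Nat.cast_one] at h
  exact h.trans (by gcongr)

/-- Bound for Riemann–Stieltjes sums when the integrand varies at most linearly in time and
in a small multiple of the integrator. -/
lemma abs_grid_sum_le_of_variation {a W : ℝ → ℝ} {H P B L M V ε : ℝ} (hH : H ∈ Set.Ioo (0:ℝ) 1)
    (hL : 0 ≤ L) (hB : 0 ≤ B) (hε : 0 ≤ ε)
    (haP : ∀ t ∈ Set.Icc (0:ℝ) 1, |a t| ≤ P) (hWB : ∀ t ∈ Set.Icc (0:ℝ) 1, |W t| ≤ B)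
    (ha : ∀ s ∈ Set.Icc (0:ℝ) 1, ∀ t ∈ Set.Icc (0:ℝ) 1,
      |a t - a s| ≤ L * (M * |t - s| + ε * |W t - W s|))
    {n : ℕ} (hn : 0 < n)
    (hV : (∑ k ∈ Finset.range n, |W (((k : ℝ) + 1) / n) - W ((k : ℝ) / n)| ^ (1 / H)) ^ H ≤ V) :
    |∑ k ∈ Finset.range n, a ((k : ℝ) / n) * (W (((k : ℝ) + 1) / n) - W ((k : ℝ) / n))|
      ≤ 2 * P * B + L * B * (M + ε * ((n : ℝ) ^ (1 - H) * V)) := by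
  have hn0 : (0:ℝ) < n := by exact_mod_cast hn
  have h := abs_sum_mul_sub_le_by_parts (fun k : ℕ => a ((k : ℝ) / n))
    (fun k : ℕ => W ((k : ℝ) / n)) n
  simp only [Nat.cast_zero, zero_div, div_self hn0.ne', Nat.cast_add, Nat.cast_one] at h
  have hP : 0 ≤ P := (abs_nonneg _).trans (haP 0 (by simp))
  have h1 : |a 1| * |W 1| ≤ P * B :=
    mul_le_mul (haP 1 (by simp)) (hWB 1 (by simp)) (abs_nonneg _) hP
  have h2 : |a 0| * |W 0| ≤ P * B :=
    mul_le_mul (haP 0 (by simp)) (hWB 0 (by simp)) (abs_nonneg _) hP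
  have hvar := (sum_abs_le_card_rpow_mul (n := n) hH
    (u := fun k => W (((k : ℝ) + 1) / n) - W ((k : ℝ) / n))).trans
      (mul_le_mul_of_nonneg_left hV (by positivity))
  have h3 : ∑ k ∈ Finset.range n, |a (((k : ℝ) + 1) / n) - a ((k : ℝ) / n)|
        * |W (((k : ℝ) + 1) / n)| ≤ L * B * (M + ε * ((n : ℝ) ^ (1 - H) * V)) := by
    calc _ ≤ ∑ k ∈ Finset.range n,
          L * B * (M * (1 / n) + ε * |W (((k : ℝ) + 1) / n) - W ((k : ℝ) / n)|) := by
          refine Finset.sum_le_sum fun k hk => ?_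
          have hk := Finset.mem_range.mp hk
          have m1 := div_mem_unitInterval hk.le
          have m2 : ((k : ℝ) + 1) / n ∈ Set.Icc (0:ℝ) 1 := by
            exact_mod_cast div_mem_unitInterval (Nat.succ_le_of_lt hk)
          have ea := ha _ m1 _ m2
          rw [grid_sub, abs_of_nonneg (by positivity : (0:ℝ) ≤ 1 / n)] at ea
          refine (mul_le_mul ea (hWB _ m2) (abs_nonneg _) ((abs_nonneg _).trans ea)).trans
            (le_of_eq (by ring))
      _ = L * B * (M + ε * ∑ k ∈ Finset.range n, |W (((k : ℝ) + 1) / n) - W ((k : ℝ) / n)|) := by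
          rw [← Finset.mul_sum, Finset.sum_add_distrib, Finset.sum_const, Finset.card_range,
            nsmul_eq_mul, ← Finset.mul_sum]
          field_simp
      _ ≤ _ := by gcongr
  linarith

/-- Stability of an additively perturbed integral equation. -/
lemma abs_sub_le_of_perturbed_integral_eq {β x X e : ℝ → ℝ} {x0 c η : ℝ} (hc : 0 < c)
    (hβ : ∀ y z, |β y - β z| ≤ c * |y - z|) (hβc : Continuous β)
    (hxc : ContinuousOn x (Set.Icc 0 1)) (hXc : ContinuousOn X (Set.Icc 0 1))
    (hx : ∀ t ∈ Set.Icc (0:ℝ) 1, x t = x0 + ∫ s in (0:ℝ)..t, β (x s))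
    (hX : ∀ t ∈ Set.Icc (0:ℝ) 1, X t = x0 + (∫ s in (0:ℝ)..t, β (X s)) + e t)
    (he : ∀ t ∈ Set.Icc (0:ℝ) 1, |e t| ≤ η) :
    ∀ t ∈ Set.Icc (0:ℝ) 1, |X t - x t| ≤ η * Real.exp c := by
  refine abs_le_mul_exp_of_le_add_mul_integral hc ((abs_nonneg _).trans (he 0 (by simp)))
    (hXc.sub hxc) fun t ht => ?_
  have hsub : Set.Icc 0 t ⊆ Set.Icc (0:ℝ) 1 := Set.Icc_subset_Icc_right ht.2
  have i1 : IntervalIntegrable (fun s => β (X s)) MeasureTheory.volume 0 t :=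
    (hβc.comp_continuousOn (hXc.mono hsub)).intervalIntegrable_of_Icc ht.1
  have i2 : IntervalIntegrable (fun s => β (x s)) MeasureTheory.volume 0 t :=
    (hβc.comp_continuousOn (hxc.mono hsub)).intervalIntegrable_of_Icc ht.1
  have i3 : IntervalIntegrable (fun s => |X s - x s|) MeasureTheory.volume 0 t :=
    ((hXc.sub hxc).mono hsub).abs.intervalIntegrable_of_Icc ht.1
  have e1 : X t - x t = e t + ∫ s in (0:ℝ)..t, (β (X s) - β (x s)) := by
    rw [hX t ht, hx t ht, intervalIntegral.integral_sub i1 i2]; ring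
  rw [e1]
  refine (abs_add_le _ _).trans (add_le_add (he t ht) ?_)
  calc _ ≤ ∫ s in (0:ℝ)..t, |β (X s) - β (x s)| :=
        intervalIntegral.abs_integral_le_integral_abs ht.1
    _ ≤ ∫ s in (0:ℝ)..t, c * |X s - x s| :=
        intervalIntegral.integral_mono_on ht.1 (i1.sub i2).abs (i3.const_mul c)
          fun s _ => hβ _ _
    _ = _ := intervalIntegral.integral_const_mul _ _

lemma increment_of_integral_eq {β X e : ℝ → ℝ} {x0 : ℝ} (hβc : Continuous β)
    (hXc : ContinuousOn X (Set.Icc 0 1))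
    (hX : ∀ t ∈ Set.Icc (0:ℝ) 1, X t = x0 + (∫ s in (0:ℝ)..t, β (X s)) + e t)
    {s t : ℝ} (hs : s ∈ Set.Icc (0:ℝ) 1) (ht : t ∈ Set.Icc (0:ℝ) 1) :
    X t - X s = (∫ u in s..t, β (X u)) + (e t - e s) := by
  have hi : ∀ r ∈ Set.Icc (0:ℝ) 1,
      IntervalIntegrable (fun u => β (X u)) MeasureTheory.volume 0 r := fun r hr =>
    (hβc.comp_continuousOn (hXc.mono (Set.Icc_subset_Icc_right hr.2))).intervalIntegrable_of_Icc
      hr.1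
  rw [hX t ht, hX s hs, ← intervalIntegral.integral_interval_sub_left (hi t ht) (hi s hs)]
  ring

lemma abs_increment_le_of_integral_eq {β X e : ℝ → ℝ} {x0 M : ℝ} (hβc : Continuous β)
    (hXc : ContinuousOn X (Set.Icc 0 1))
    (hX : ∀ t ∈ Set.Icc (0:ℝ) 1, X t = x0 + (∫ s in (0:ℝ)..t, β (X s)) + e t)
    (hM : ∀ t ∈ Set.Icc (0:ℝ) 1, |β (X t)| ≤ M)
    {s t : ℝ} (hs : s ∈ Set.Icc (0:ℝ) 1) (ht : t ∈ Set.Icc (0:ℝ) 1) :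
    |X t - X s| ≤ M * |t - s| + |e t - e s| := by
  rw [increment_of_integral_eq hβc hXc hX hs ht]
  refine (abs_add_le _ _).trans (add_le_add_left ?_ _)
  refine intervalIntegral.norm_integral_le_of_norm_le_const (f := fun u => β (X u)) (C := M)
    fun u hu => hM u ?_
  exact (Set.uIcc_subset_Icc hs ht) (Set.uIoc_subset_uIcc hu)

/-- The weighted sum of Euler residuals of an integral equation, up to its noise part. -/
lemma abs_euler_residual_sum_le {β X e : ℝ → ℝ} {x0 c δ P : ℝ} {p : ℕ → ℝ} {n : ℕ} (hn : 0 < n)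
    (hc : 0 ≤ c) (hβ : ∀ y z, |β y - β z| ≤ c * |y - z|) (hβc : Continuous β)
    (hXc : ContinuousOn X (Set.Icc 0 1))
    (hX : ∀ t ∈ Set.Icc (0:ℝ) 1, X t = x0 + (∫ s in (0:ℝ)..t, β (X s)) + e t)
    (hp : ∀ k < n, |p k| ≤ P)
    (hδ : ∀ k < n, ∀ s ∈ Set.Icc ((k : ℝ) / n) (((k : ℝ) + 1) / n), |X s - X ((k : ℝ) / n)| ≤ δ) :
    |(∑ k ∈ Finset.range n, p k * (X (((k : ℝ) + 1) / n) - X ((k : ℝ) / n)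
        - (1 / n) * β (X ((k : ℝ) / n))))
      - ∑ k ∈ Finset.range n, p k * (e (((k : ℝ) + 1) / n) - e ((k : ℝ) / n))| ≤ P * (c * δ) := by
  have hn0 : (0:ℝ) < n := by exact_mod_cast hn
  rw [← Finset.sum_sub_distrib]
  calc _ ≤ ∑ k ∈ Finset.range n, P * (c * δ * (1 / n)) := by
        refine (Finset.abs_sum_le_sum_abs _ _).trans (Finset.sum_le_sum fun k hk => ?_)
        have hk := Finset.mem_range.mp hk
        have m1 := div_mem_unitInterval hk.le
        have m2 : ((k : ℝ) + 1) / n ∈ Set.Icc (0:ℝ) 1 := by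
          exact_mod_cast div_mem_unitInterval (Nat.succ_le_of_lt hk)
        have hi := abs_integral_sub_mul_le (f := fun s => β (X s)) (y := β (X ((k : ℝ) / n)))
          (δ := c * δ) (grid_le k n)
          (hβc.comp_continuousOn (hXc.mono (Icc_grid_subset hk)))
          fun s hs => (hβ _ _).trans (mul_le_mul_of_nonneg_left (hδ k hk s hs) hc)
        rw [grid_sub] at hi
        rw [increment_of_integral_eq hβc hXc hX m1 m2, ← mul_sub, abs_mul]
        refine mul_le_mul (hp k hk) (le_of_eq_of_le ?_ hi) (abs_nonneg _)
          ((abs_nonneg _).trans (hp k hk))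
        congr 1
        ring
    _ = P * (c * δ) := by
        rw [Finset.sum_const, Finset.card_range, nsmul_eq_mul]; field_simp

lemma exists_bound_of_holder {W : ℝ → ℝ} {lam C : ℝ} (hl : 0 ≤ lam)
    (h : ∀ s ∈ Set.Icc (0:ℝ) 1, ∀ t ∈ Set.Icc (0:ℝ) 1, |W t - W s| ≤ C * |t - s| ^ lam) :
    ∃ B, 0 ≤ B ∧ ∀ t ∈ Set.Icc (0:ℝ) 1, |W t| ≤ B := by
  refine ⟨|W 0| + |C|, by positivity, fun t ht => ?_⟩
  have h1 : |W t - W 0| ≤ |C| := by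
    refine (h 0 (by simp) t ht).trans ((mul_le_mul_of_nonneg_right (le_abs_self C)
      (by positivity)).trans (mul_le_of_le_one_right (abs_nonneg _) ?_))
    rw [sub_zero, abs_of_nonneg ht.1]
    exact Real.rpow_le_one ht.1 ht.2 hl
  have := abs_sub_abs_le_abs_sub (W t) (W 0)
  linarith

/-- The `θ_j`-derivative of a weighted sum of drift residuals. -/
lemma hasDerivAt_sum_mul_residual {f g : ℕ → ℝ → ℝ} {f' g' u : ℕ → ℝ} {h s : ℝ} (n : ℕ)
    (hf : ∀ k, HasDerivAt (f k) (f' k) s) (hg : ∀ k, HasDerivAt (g k) (g' k) s) :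
    HasDerivAt (fun r => ∑ k ∈ Finset.range n, f k r * (u k - h * g k r))
      (∑ k ∈ Finset.range n, (f' k * (u k - h * g k s) - h * (f k s * g' k))) s := by
  refine HasDerivAt.fun_sum fun k _ => ?_
  refine ((hf k).mul (((hg k).const_mul h).const_sub (u k))).congr_deriv ?_
  ring

/-- Noise sums against a path that is uniformly Lipschitz in time and in the scaled noise vanish,
uniformly over the family of paths. -/
lemma exists_noise_rate {ι : Type*} {H P L M : ℝ} {W : ℝ → ℝ} {a : ℝ → ι → ℝ → ℝ}
    (hH : H ∈ Set.Ioo (0:ℝ) 1) (hL : 0 ≤ L) (hM : 0 ≤ M)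
    (hWH : ∀ lam ∈ Set.Ioo (0:ℝ) H, ∃ CW : ℝ, ∀ s ∈ Set.Icc (0:ℝ) 1, ∀ t ∈ Set.Icc (0:ℝ) 1,
      |W t - W s| ≤ CW * |t - s| ^ lam)
    (hWV : ∃ V : ℝ, ∀ n : ℕ, 1 ≤ n →
      (∑ k ∈ Finset.range n, |W (((k : ℝ) + 1) / n) - W ((k : ℝ) / n)| ^ (1 / H)) ^ H ≤ V)
    (haP : ∀ ε ∈ Set.Ioc (0:ℝ) 1, ∀ i, ∀ t ∈ Set.Icc (0:ℝ) 1, |a ε i t| ≤ P)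
    (ha : ∀ ε ∈ Set.Ioc (0:ℝ) 1, ∀ i, ∀ s ∈ Set.Icc (0:ℝ) 1, ∀ t ∈ Set.Icc (0:ℝ) 1,
      |a ε i t - a ε i s| ≤ L * (M * |t - s| + ε * |W t - W s|))
    {ns : ℕ → ℕ} {es : ℕ → ℝ} (hes : Tendsto es atTop (nhds 0))
    (hcond : 1 / 2 < H ∨ (H ≤ 1 / 2 ∧
        Tendsto (fun m => (es m) ^ 2 * (ns m : ℝ) ^ (1 - H)) atTop (nhds 0))) :
    ∃ r : ℕ → ℝ, Tendsto r atTop (nhds 0) ∧ ∀ m, es m ∈ Set.Ioc (0:ℝ) 1 → 1 ≤ ns m → ∀ i,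
      |es m * ∑ k ∈ Finset.range (ns m), a (es m) i ((k : ℝ) / ns m)
        * (W (((k : ℝ) + 1) / ns m) - W ((k : ℝ) / ns m))| ≤ r m := by
  rcases hcond with hH2 | ⟨-, hlim⟩
  · obtain ⟨lam, hl, hlH⟩ := exists_between hH2
    obtain ⟨C, hC⟩ := hWH lam ⟨by linarith, hlH⟩
    have hC' : ∀ s ∈ Set.Icc (0:ℝ) 1, ∀ t ∈ Set.Icc (0:ℝ) 1, |W t - W s| ≤ |C| * |t - s| ^ lam :=
      fun s hs t ht => (hC s hs t ht).trans
        (mul_le_mul_of_nonneg_right (le_abs_self C) (by positivity))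
    refine ⟨fun m => es m * (P * |C| + L * (M + |C|) * |C| / (1 - (2 / 3 : ℝ) ^ (2 * lam - 1))),
      by simpa using hes.mul_const _, fun m hm hn i => ?_⟩
    have hhol : ∀ s ∈ Set.Icc (0:ℝ) 1, ∀ t ∈ Set.Icc (0:ℝ) 1,
        |a (es m) i t - a (es m) i s| ≤ L * (M + |C|) * |t - s| ^ lam := by
      intro s hs t ht
      have hd : |t - s| ≤ 1 := abs_le.mpr ⟨by linarith [hs.2, ht.1], by linarith [hs.1, ht.2]⟩
      have hdl : |t - s| ≤ |t - s| ^ lam :=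
        Real.self_le_rpow_of_le_one (abs_nonneg _) hd (by linarith [hH.2])
      calc _ ≤ L * (M * |t - s| + es m * |W t - W s|) := ha _ hm i s hs t ht
        _ ≤ L * (M * |t - s| ^ lam + 1 * (|C| * |t - s| ^ lam)) := by
            have := hC' s hs t ht
            have := hm.2
            gcongr
        _ = _ := by ring
    rw [abs_mul, abs_of_pos hm.1]
    refine mul_le_mul_of_nonneg_left ((abs_grid_sum_le_of_holder hl (by positivity)
      (abs_nonneg C) hhol hC' hn).trans ?_) hm.1.le
    have := haP _ hm i 0 (by simp)
    gcongr
  · obtain ⟨C, hC⟩ := hWH (H / 2) ⟨by linarith [hH.1], by linarith [hH.1]⟩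
    obtain ⟨B, hB, hWB⟩ := exists_bound_of_holder (by linarith [hH.1]) hC
    obtain ⟨V, hV⟩ := hWV
    refine ⟨fun m => es m * (2 * P * B + L * B * M)
      + L * B * V * ((es m) ^ 2 * (ns m : ℝ) ^ (1 - H)),
      by simpa using (hes.mul_const _).add (hlim.const_mul _), fun m hm hn i => ?_⟩
    have h := abs_grid_sum_le_of_variation hH hL hB hm.1.le (haP _ hm i) hWB (ha _ hm i) hn
      (hV _ hn)
    rw [abs_mul, abs_of_pos hm.1]
    exact (mul_le_mul_of_nonneg_left h hm.1.le).trans (le_of_eq (by ring))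

/-- Hessian decomposition and uniform limit (Lemma 10, deterministic core):
`K^{i,j}_{n,ε}(θ) = ∂_{θ_j} G^i_{n,ε}(θ)` decomposes algebraically, and under (A1),
(A3)–(A4) and either `H > 1/2`, or `H ≤ 1/2` with `ε² n^{1-H} → 0`, it converges to
`K^{i,j}(θ)` uniformly over `θ ∈ Θ`. -/
theorem hessian_decomposition_and_limit {d : ℕ} (H c x0 C0 : ℝ) (N : ℕ)
    (hH : H ∈ Set.Ioo (0:ℝ) 1) (hc : 0 < c) (hC0 : 0 < C0)
    -- (A1)
    (Θ : Set (EuclideanSpace ℝ (Fin d))) (hΘo : IsOpen Θ)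
    (hΘb : Bornology.IsBounded Θ) (hΘc : Convex ℝ Θ)
    (θ0 : EuclideanSpace ℝ (Fin d)) (hθ0 : θ0 ∈ Θ) (i j : Fin d)
    (b dbi dbj dbij : ℝ → EuclideanSpace ℝ (Fin d) → ℝ)
    -- partial derivatives in the θ_j direction
    (hdbj : ∀ (y : ℝ) (θ : EuclideanSpace ℝ (Fin d)),
      HasDerivAt (fun s : ℝ => b y (θ + s • EuclideanSpace.single j (1:ℝ))) (dbj y θ) 0)
    (hdbij : ∀ (y : ℝ) (θ : EuclideanSpace ℝ (Fin d)),
      HasDerivAt (fun s : ℝ => dbi y (θ + s • EuclideanSpace.single j (1:ℝ))) (dbij y θ) 0)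
    -- (A3)
    (hbL : ∀ θ (y z : ℝ), |b y θ - b z θ| ≤ c * |y - z|)
    (hbG : ∀ θ (y : ℝ), |b y θ| ≤ c * (1 + |y|))
    (hbθ : ∀ (y : ℝ) θ1 θ2, |b y θ1 - b y θ2| ≤ c * (1 + |y| ^ N) * ‖θ1 - θ2‖)
    -- (A4): polynomial bounds and Lipschitz continuity of the derivatives
    (hdbiB : ∀ θ (y : ℝ), |dbi y θ| ≤ C0 * (1 + |y| ^ N))
    (hdbjB : ∀ θ (y : ℝ), |dbj y θ| ≤ C0 * (1 + |y| ^ N))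
    (hdbijB : ∀ θ (y : ℝ), |dbij y θ| ≤ C0 * (1 + |y| ^ N))
    (hdbiL : ∀ θ (y z : ℝ), |dbi y θ - dbi z θ| ≤ C0 * (1 + |y| ^ N + |z| ^ N) * |y - z|)
    (hdbjL : ∀ θ (y z : ℝ), |dbj y θ - dbj z θ| ≤ C0 * (1 + |y| ^ N + |z| ^ N) * |y - z|)
    (hdbijL : ∀ θ (y z : ℝ), |dbij y θ - dbij z θ| ≤ C0 * (1 + |y| ^ N + |z| ^ N) * |y - z|)
    (hdbiθ : ∀ (y : ℝ) θ1 θ2, |dbi y θ1 - dbi y θ2| ≤ C0 * (1 + |y| ^ N) * ‖θ1 - θ2‖)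
    (hdbjθ : ∀ (y : ℝ) θ1 θ2, |dbj y θ1 - dbj y θ2| ≤ C0 * (1 + |y| ^ N) * ‖θ1 - θ2‖)
    (hdbijθ : ∀ (y : ℝ) θ1 θ2, |dbij y θ1 - dbij y θ2| ≤ C0 * (1 + |y| ^ N) * ‖θ1 - θ2‖)
    -- the driving path: λ-Hölder for every λ < H, with finite 1/H-variation sums
    (W : ℝ → ℝ)
    (hWH : ∀ lam ∈ Set.Ioo (0:ℝ) H, ∃ CW : ℝ, ∀ s ∈ Set.Icc (0:ℝ) 1, ∀ t ∈ Set.Icc (0:ℝ) 1,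
      |W t - W s| ≤ CW * |t - s| ^ lam)
    (hWV : ∃ V : ℝ, ∀ n : ℕ, 1 ≤ n →
      (∑ k ∈ Finset.range n, |W (((k : ℝ) + 1) / n) - W ((k : ℝ) / n)| ^ (1 / H)) ^ H ≤ V)
    -- the ODE solution and the perturbed process
    (x : ℝ → ℝ) (hxc : ContinuousOn x (Set.Icc 0 1))
    (hx : ∀ t ∈ Set.Icc (0:ℝ) 1, x t = x0 + ∫ s in (0:ℝ)..t, b (x s) θ0)
    (X : ℝ → ℝ → ℝ) (hXc : ∀ ε, ContinuousOn (X ε) (Set.Icc 0 1))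
    (hX : ∀ ε > (0:ℝ), ∀ t ∈ Set.Icc (0:ℝ) 1,
      X ε t = x0 + (∫ s in (0:ℝ)..t, b (X ε s) θ0) + ε * W t)
    -- K_{n,ε} is the θ_j-derivative of the score G^i_{n,ε}
    (K : ℕ → ℝ → EuclideanSpace ℝ (Fin d) → ℝ)
    (hK : ∀ (n : ℕ) (ε : ℝ) (θ : EuclideanSpace ℝ (Fin d)),
      HasDerivAt (fun s : ℝ => ∑ k ∈ Finset.range n,
          dbi (X ε ((k : ℝ) / n)) (θ + s • EuclideanSpace.single j (1:ℝ))
            * (X ε (((k : ℝ) + 1) / n) - X ε ((k : ℝ) / n)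
              - (1 / n) * b (X ε ((k : ℝ) / n)) (θ + s • EuclideanSpace.single j (1:ℝ))))
        (K n ε θ) 0) :
    -- (a) algebraic decomposition
    (∀ (n : ℕ) (ε : ℝ) (θ : EuclideanSpace ℝ (Fin d)),
      K n ε θ = ∑ k ∈ Finset.range n, dbij (X ε ((k : ℝ) / n)) θ
          * (X ε (((k : ℝ) + 1) / n) - X ε ((k : ℝ) / n) - (1 / n) * b (X ε ((k : ℝ) / n)) θ0)
        + (1 / (n : ℝ)) * ∑ k ∈ Finset.range n,
            (dbij (X ε ((k : ℝ) / n)) θ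
                * (b (X ε ((k : ℝ) / n)) θ0 - b (X ε ((k : ℝ) / n)) θ)
              - dbi (X ε ((k : ℝ) / n)) θ * dbj (X ε ((k : ℝ) / n)) θ)) ∧
    -- (b) uniform limit
    ∀ (ns : ℕ → ℕ) (es : ℕ → ℝ), Tendsto ns atTop atTop →
      Tendsto es atTop (nhdsWithin 0 (Set.Ioi 0)) →
      (1 / 2 < H ∨ (H ≤ 1 / 2 ∧
        Tendsto (fun m => (es m) ^ 2 * (ns m : ℝ) ^ (1 - H)) atTop (nhds 0))) →
      Tendsto (fun m => sSup {y | ∃ θ ∈ Θ, y = |K (ns m) (es m) θ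
          - ((∫ s in (0:ℝ)..1, dbij (x s) θ * (b (x s) θ0 - b (x s) θ))
            - ∫ s in (0:ℝ)..1, dbi (x s) θ * dbj (x s) θ)|})
        atTop (nhds 0) := by
  have hdecomp : ∀ (n : ℕ) (ε : ℝ) (θ : EuclideanSpace ℝ (Fin d)),
      K n ε θ = ∑ k ∈ Finset.range n, dbij (X ε ((k : ℝ) / n)) θ
          * (X ε (((k : ℝ) + 1) / n) - X ε ((k : ℝ) / n) - (1 / n) * b (X ε ((k : ℝ) / n)) θ0)
        + (1 / (n : ℝ)) * ∑ k ∈ Finset.range n,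
            (dbij (X ε ((k : ℝ) / n)) θ
                * (b (X ε ((k : ℝ) / n)) θ0 - b (X ε ((k : ℝ) / n)) θ)
              - dbi (X ε ((k : ℝ) / n)) θ * dbj (X ε ((k : ℝ) / n)) θ) := by
    intro n ε θ
    rw [(hK n ε θ).unique (hasDerivAt_sum_mul_residual n
      (fun k => hdbij (X ε ((k : ℝ) / n)) θ) (fun k => hdbj (X ε ((k : ℝ) / n)) θ)),
      Finset.mul_sum, ← Finset.sum_add_distrib]
    refine Finset.sum_congr rfl fun k _ => ?_
    simp only [zero_smul, add_zero]
    ring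
  refine ⟨hdecomp, fun ns es hns hes hcond => ?_⟩
  obtain ⟨hes0, hesp⟩ := tendsto_nhdsWithin_iff.mp hes
  have hbc : ∀ θ, Continuous fun y => b y θ := fun θ =>
    continuous_of_abs_sub_le_pow (C := c) (N := 0) fun y z => (hbL θ y z).trans (by
      gcongr
      simp only [pow_zero]
      linarith)
  have hdbic : ∀ θ, Continuous fun y => dbi y θ := fun θ =>
    continuous_of_abs_sub_le_pow (hdbiL θ)
  have hdbjc : ∀ θ, Continuous fun y => dbj y θ := fun θ =>
    continuous_of_abs_sub_le_pow (hdbjL θ)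
  have hdbijc : ∀ θ, Continuous fun y => dbij y θ := fun θ =>
    continuous_of_abs_sub_le_pow (hdbijL θ)
  obtain ⟨B, hB, hWB⟩ : ∃ B, 0 ≤ B ∧ ∀ t ∈ Set.Icc (0:ℝ) 1, |W t| ≤ B := by
    obtain ⟨C, hC⟩ := hWH (H / 2) ⟨by linarith [hH.1], by linarith [hH.1]⟩
    exact exists_bound_of_holder (by linarith [hH.1]) hC
  set E : ℝ := B * Real.exp c with hE
  have hE0 : 0 ≤ E := by positivity
  have hXx : ∀ ε > (0:ℝ), ∀ t ∈ Set.Icc (0:ℝ) 1, |X ε t - x t| ≤ ε * E := by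
    intro ε hε t ht
    have := abs_sub_le_of_perturbed_integral_eq (η := ε * B) hc (hbL θ0) (hbc θ0) hxc (hXc ε) hx
      (hX ε hε) (fun t ht => by
        rw [abs_mul, abs_of_pos hε]
        exact mul_le_mul_of_nonneg_left (hWB t ht) hε.le) t ht
    rwa [mul_assoc] at this
  obtain ⟨R, hR, hxR, hXR⟩ : ∃ R : ℝ, 0 ≤ R ∧ (∀ t ∈ Set.Icc (0:ℝ) 1, |x t| ≤ R) ∧
      ∀ ε ∈ Set.Ioc (0:ℝ) 1, ∀ t ∈ Set.Icc (0:ℝ) 1, |X ε t| ≤ R := by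
    obtain ⟨R₀, hR₀⟩ := isCompact_Icc.exists_bound_of_continuousOn hxc
    have h0 : 0 ≤ R₀ := (norm_nonneg _).trans (hR₀ 0 (by simp))
    refine ⟨R₀ + E, by positivity, fun t ht => ?_, fun ε hε t ht => ?_⟩
    · have := hR₀ t ht
      rw [Real.norm_eq_abs] at this
      linarith
    · have h1 := hR₀ t ht
      rw [Real.norm_eq_abs] at h1
      have h2 := hXx ε hε.1 t ht
      have h3 := abs_sub_abs_le_abs_sub (X ε t) (x t)
      have h4 : ε * E ≤ E := mul_le_of_le_one_left hE0 hε.2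
      linarith
  set P : ℝ := C0 * (1 + R ^ N) with hP
  set L : ℝ := C0 * (1 + R ^ N + R ^ N) with hL
  set M : ℝ := c * (1 + R) with hM
  have hP0 : 0 ≤ P := by positivity
  have hL0 : 0 ≤ L := by positivity
  have hM0 : 0 ≤ M := by positivity
  have hbd : ∀ {f : ℝ → EuclideanSpace ℝ (Fin d) → ℝ},
      (∀ θ (y : ℝ), |f y θ| ≤ C0 * (1 + |y| ^ N)) → ∀ θ y, |y| ≤ R → |f y θ| ≤ P :=
    fun hf θ y hy => (hf θ y).trans (by rw [hP]; gcongr)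
  have hlip : ∀ {f : ℝ → EuclideanSpace ℝ (Fin d) → ℝ},
      (∀ θ (y z : ℝ), |f y θ - f z θ| ≤ C0 * (1 + |y| ^ N + |z| ^ N) * |y - z|) →
      ∀ θ y z, |y| ≤ R → |z| ≤ R → |f y θ - f z θ| ≤ L * |y - z| :=
    fun hf θ y z hy hz => (hf θ y z).trans (by rw [hL]; gcongr)
  have hbM : ∀ θ y, |y| ≤ R → |b y θ| ≤ M := fun θ y hy => (hbG θ y).trans (by rw [hM]; gcongr)
  have hxinc : ∀ s ∈ Set.Icc (0:ℝ) 1, ∀ t ∈ Set.Icc (0:ℝ) 1, |x t - x s| ≤ M * |t - s| := by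
    intro s hs t ht
    simpa using abs_increment_le_of_integral_eq (e := fun _ => 0) (hbc θ0) hxc
      (fun t ht => by rw [hx t ht, add_zero]) (fun t ht => hbM θ0 _ (hxR t ht)) hs ht
  have hXinc : ∀ ε ∈ Set.Ioc (0:ℝ) 1, ∀ s ∈ Set.Icc (0:ℝ) 1, ∀ t ∈ Set.Icc (0:ℝ) 1,
      |X ε t - X ε s| ≤ M * |t - s| + ε * |W t - W s| := by
    intro ε hε s hs t ht
    have := abs_increment_le_of_integral_eq (e := fun t => ε * W t) (hbc θ0) (hXc ε)
      (hX ε hε.1) (fun t ht => hbM θ0 _ (hXR ε hε t ht)) hs ht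
    rwa [← mul_sub, abs_mul, abs_of_pos hε.1] at this
  obtain ⟨r, hr, hnoise⟩ := exists_noise_rate (a := fun ε θ t => dbij (X ε t) θ) hH hL0 hM0
    hWH hWV (fun ε hε θ t ht => hbd hdbijB θ _ (hXR ε hε t ht))
    (fun ε hε θ s hs t ht => (hlip hdbijL θ _ _ (hXR ε hε t ht) (hXR ε hε s hs)).trans
      (mul_le_mul_of_nonneg_left (hXinc ε hε s hs t ht) hL0)) hes0 hcond
  set g : EuclideanSpace ℝ (Fin d) → ℝ → ℝ := fun θ y =>
    dbij y θ * (b y θ0 - b y θ) - dbi y θ * dbj y θ with hg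
  set G : ℝ := L * (2 * M) + P * (2 * c) + (L * P + P * L) with hG
  have hG0 : 0 ≤ G := by positivity
  have hgc : ∀ θ, Continuous (g θ) := fun θ =>
    ((hdbijc θ).mul ((hbc θ0).sub (hbc θ))).sub ((hdbic θ).mul (hdbjc θ))
  have hgL : ∀ θ y z, |y| ≤ R → |z| ≤ R → |g θ y - g θ z| ≤ G * |y - z| := by
    intro θ y z hy hz
    have hb2 : |b y θ0 - b y θ| ≤ 2 * M :=
      (abs_sub _ _).trans (by linarith [hbM θ0 y hy, hbM θ y hy])
    have hb3 : |(b y θ0 - b y θ) - (b z θ0 - b z θ)| ≤ 2 * c * |y - z| := by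
      rw [sub_sub_sub_comm]
      exact (abs_sub _ _).trans (by linarith [hbL θ0 y z, hbL θ y z])
    have h1 := abs_mul_sub_mul_le hb2 (hbd hdbijB θ z hz) (hlip hdbijL θ y z hy hz) hb3
    have h2 := abs_mul_sub_mul_le (hbd hdbjB θ y hy) (hbd hdbiB θ z hz) (hlip hdbiL θ y z hy hz)
      (hlip hdbjL θ y z hy hz)
    simp only [hg]
    rw [sub_sub_sub_comm]
    exact (abs_sub _ _).trans ((add_le_add h1 h2).trans (le_of_eq (by rw [hG]; ring)))
  have hbound : ∀ m, es m ∈ Set.Ioc (0:ℝ) 1 → 1 ≤ ns m → ∀ θ,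
      |K (ns m) (es m) θ - ((∫ s in (0:ℝ)..1, dbij (x s) θ * (b (x s) θ0 - b (x s) θ))
            - ∫ s in (0:ℝ)..1, dbi (x s) θ * dbj (x s) θ)|
        ≤ (P * c + G) * (2 * (es m * E) + M * (1 / ns m)) + r m := by
    intro m hm hn θ
    set n := ns m
    set ε := es m
    have hcell : ∀ k < n, ∀ s ∈ Set.Icc ((k : ℝ) / n) (((k : ℝ) + 1) / n),
        s ∈ Set.Icc (0:ℝ) 1 ∧ |x s - X ε ((k : ℝ) / n)| ≤ ε * E + M * (1 / n) := by
      intro k hk s hs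
      have hk1 := div_mem_unitInterval hk.le
      have hs1 := Icc_grid_subset hk hs
      refine ⟨hs1, ?_⟩
      have h1 := hxinc _ hk1 _ hs1
      have h2 : |s - (k : ℝ) / n| ≤ 1 / n := by
        rw [abs_of_nonneg (by linarith [hs.1]), ← grid_sub k n]
        linarith [hs.2]
      have h3 := mul_le_mul_of_nonneg_left h2 hM0
      have h4 := hXx ε hm.1 _ hk1
      rw [abs_sub_comm] at h4
      have h5 := abs_sub_le (x s) (x ((k : ℝ) / n)) (X ε ((k : ℝ) / n))
      linarith
    have hdrift := abs_euler_residual_sum_le (p := fun k => dbij (X ε ((k : ℝ) / n)) θ) (P := P)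
      (δ := 2 * (ε * E) + M * (1 / n)) (e := fun t => ε * W t) hn hc.le (hbL θ0) (hbc θ0) (hXc ε)
      (hX ε hm.1) (fun k hk => hbd hdbijB θ _ (hXR ε hm _ (div_mem_unitInterval hk.le)))
      (fun k hk s hs => by
        obtain ⟨hs1, h1⟩ := hcell k hk s hs
        have h2 := hXx ε hm.1 s hs1
        have h3 := abs_sub_le (X ε s) (x s) (X ε ((k : ℝ) / n))
        linarith)
    have hriemann := abs_riemann_sum_sub_integral_le (f := fun s => g θ (x s))
      (y := fun k => g θ (X ε ((k : ℝ) / n))) (n := n)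
      (δ := G * (2 * (ε * E) + M * (1 / n))) hn ((hgc θ).comp_continuousOn hxc)
      (fun k hk s hs => by
        obtain ⟨hs1, h1⟩ := hcell k hk s hs
        refine (hgL θ _ _ (hxR s hs1) (hXR ε hm _ (div_mem_unitInterval hk.le))).trans
          (mul_le_mul_of_nonneg_left ?_ hG0)
        linarith [mul_nonneg hm.1.le hE0])
    have hint : (∫ s in (0:ℝ)..1, g θ (x s))
        = (∫ s in (0:ℝ)..1, dbij (x s) θ * (b (x s) θ0 - b (x s) θ))
            - ∫ s in (0:ℝ)..1, dbi (x s) θ * dbj (x s) θ := by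
      refine intervalIntegral.integral_sub ?_ ?_
      · exact (((hdbijc θ).mul ((hbc θ0).sub (hbc θ))).comp_continuousOn
          hxc).intervalIntegrable_of_Icc zero_le_one
      · exact (((hdbic θ).mul (hdbjc θ)).comp_continuousOn hxc).intervalIntegrable_of_Icc
          zero_le_one
    have hn' := hnoise m hm hn θ
    have hW : ∑ k ∈ Finset.range n, dbij (X ε ((k : ℝ) / n)) θ
          * (ε * W (((k : ℝ) + 1) / n) - ε * W ((k : ℝ) / n))
        = ε * ∑ k ∈ Finset.range n, dbij (X ε ((k : ℝ) / n)) θ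
          * (W (((k : ℝ) + 1) / n) - W ((k : ℝ) / n)) := by
      rw [Finset.mul_sum]
      exact Finset.sum_congr rfl fun k _ => by ring
    rw [hW] at hdrift
    rw [← hint, hdecomp]
    rw [abs_le] at hdrift hriemann hn' ⊢
    constructor <;> linarith [hdrift.1, hdrift.2, hriemann.1, hriemann.2, hn'.1, hn'.2]
  have hrate : Tendsto (fun m => (P * c + G) * (2 * (es m * E) + M * (1 / (ns m : ℝ))) + r m)
      atTop (nhds 0) := by
    have h1 : Tendsto (fun m => 1 / (ns m : ℝ)) atTop (nhds 0) :=
      tendsto_one_div_atTop_nhds_zero_nat.comp hns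
    simpa using ((((hes0.mul_const E).const_mul 2).add (h1.const_mul M)).const_mul
      (P * c + G)).add hr
  have hev : ∀ᶠ m in atTop, es m ∈ Set.Ioc (0:ℝ) 1 ∧ 1 ≤ ns m := by
    filter_upwards [hesp, hes0.eventually_le_const zero_lt_one, hns.eventually_ge_atTop 1]
      with m h1 h2 h3 using ⟨⟨h1, h2⟩, h3⟩
  refine squeeze_zero' (Eventually.of_forall fun m => ?_) ?_ hrate
  · refine Real.sSup_nonneg ?_
    rintro _ ⟨θ, -, rfl⟩
    exact abs_nonneg _
  · filter_upwards [hev] with m hm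
    refine csSup_le ⟨_, θ0, hθ0, rfl⟩ ?_
    rintro _ ⟨θ, -, rfl⟩
    exact hbound m hm.1 hm.2 θ
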